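/- Let Im τ > 0, let N ≥ 1 be an integer, let a ∈ {0,…,N−1}, and let w, z ∈ ℂ satisfy: −Im τ < Im z < 0; w ∉ 2πiΩ_a; w ≠ 0 if a = 0; θ₁(z|τ) ≠ 0; and θ₁((w + 2πi(a/N)τ)/(2πi)|τ) ≠ 0. Set f_a(u) := (1/2)·(1 + coth(u/2)) − δ_{a,0}/u. Then the family n ↦ e^{2πizn}·(1 + coth(w/2 + πi(a/N)τ + πiτn)), indexed by n ∈ ℤ∖{0}, is absolutely summable, and χ_a(w,z|τ) = e^{2πiaz/N}·( f_a(w + 2πi(a/N)τ) + (1/2)·∑_{n∈ℤ∖{0}} e^{2πizn}·(1 + coth(w/2 + πi(a/N)τ + πiτn)) ). -/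

import Mathlib

open Complex

/-- The theta function `θ₁(z|τ) = −∑_{j∈ℤ} exp(πi(j+1/2)²τ + 2πi(j+1/2)(z+1/2))`. -/
noncomputable def theta1 (z τ : ℂ) : ℂ :=
  -∑' j : ℤ, Complex.exp ((Real.pi : ℂ) * I * ((j : ℂ) + 1 / 2) ^ 2 * τ +
      2 * (Real.pi : ℂ) * I * ((j : ℂ) + 1 / 2) * (z + 1 / 2))

/-- The derivative `θ₁'(z|τ)` of `θ₁` in its first variable. -/
noncomputable def theta1Deriv (z τ : ℂ) : ℂ := deriv (fun u => theta1 u τ) z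

/-- The hyperbolic cotangent `coth u = cosh u / sinh u`. -/
noncomputable def coth (u : ℂ) : ℂ := Complex.cosh u / Complex.sinh u

/-- `χ(w,z|τ) := (1/(2πi)) · θ₁(w/(2πi) + z|τ) · θ₁'(0|τ) / (θ₁(z|τ) · θ₁(w/(2πi)|τ))`. -/
noncomputable def chi (w z τ : ℂ) : ℂ :=
  (1 / (2 * (Real.pi : ℂ) * I)) * theta1 (w / (2 * (Real.pi : ℂ) * I) + z) τ *
    theta1Deriv 0 τ / (theta1 z τ * theta1 (w / (2 * (Real.pi : ℂ) * I)) τ)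

/-- `χ_a(w,z|τ) := exp(2πiaz/N)·(χ(w + 2πi(a/N)τ, z|τ) − δ_{a,0}/w)`. -/
noncomputable def chia (N a : ℕ) (w z τ : ℂ) : ℂ :=
  Complex.exp (2 * (Real.pi : ℂ) * I * (a : ℂ) * z / (N : ℂ)) *
    (chi (w + 2 * (Real.pi : ℂ) * I * ((a : ℂ) / (N : ℂ)) * τ) z τ -
      if a = 0 then 1 / w else 0)

open Filter Topology

/-- The Laurent coefficient `1 / (1 - (X qⁿ)⁻¹)` of the Kronecker series. -/
noncomputable def kroneckerCoeff (q X : ℂ) (n : ℤ) : ℂ := (1 - (X * q ^ n)⁻¹)⁻¹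

lemma exists_norm_inv_one_sub_mul_pow_le {q : ℂ} (hq : ‖q‖ < 1) (a : ℂ) :
    ∃ B : ℝ, ∀ k : ℕ, ‖(1 - a * q ^ k)⁻¹‖ ≤ B := by
  have h : Tendsto (fun k : ℕ => (1 - a * q ^ k)⁻¹) atTop (𝓝 (1 - a * 0)⁻¹) :=
    (((tendsto_pow_atTop_nhds_zero_of_norm_lt_one hq).const_mul a).const_sub 1).inv₀ (by simp)
  obtain ⟨B, hB⟩ := (Metric.isBounded_range_of_tendsto _ h).exists_norm_le
  exact ⟨B, fun k => hB _ ⟨k, rfl⟩⟩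

lemma exists_norm_kroneckerCoeff_sub_le {q X : ℂ} (hq0 : q ≠ 0) (hq : ‖q‖ < 1) (hX0 : X ≠ 0)
    (hX : ∀ n : ℤ, X * q ^ n ≠ 1) :
    ∃ B : ℝ, 0 ≤ B ∧ ∀ n : ℤ,
      ‖kroneckerCoeff q X n - (if n < 0 then 1 else 0)‖ ≤ B * ‖q‖ ^ n.natAbs := by
  obtain ⟨B₁, h₁⟩ := exists_norm_inv_one_sub_mul_pow_le hq X
  obtain ⟨B₂, h₂⟩ := exists_norm_inv_one_sub_mul_pow_le hq X⁻¹
  have hB₁ : 0 ≤ B₁ := (norm_nonneg _).trans (h₁ 0)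
  have hB₂ : 0 ≤ B₂ := (norm_nonneg _).trans (h₂ 0)
  refine ⟨‖X‖ * B₁ + ‖X⁻¹‖ * B₂, by positivity, fun n => ?_⟩
  obtain ⟨k, rfl | rfl⟩ := n.eq_nat_or_neg
  · have hk := hX k
    have e : kroneckerCoeff q X k = -(X * (1 - X * q ^ k)⁻¹) * q ^ k := by
      rw [zpow_natCast] at hk
      have h1 : 1 - X * q ^ k ≠ 0 := sub_ne_zero.2 hk.symm
      have h2 : X * q ^ k - 1 ≠ 0 := sub_ne_zero.2 hk
      have hqk : q ^ k ≠ 0 := pow_ne_zero _ hq0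
      rw [kroneckerCoeff, zpow_natCast]
      have h3 : 1 - (X * q ^ k)⁻¹ = -(1 - X * q ^ k) / (X * q ^ k) := by field_simp; ring
      rw [h3, inv_div]
      field_simp
    rw [if_neg (by omega), sub_zero, e, norm_mul, norm_neg, norm_mul, norm_pow, Int.natAbs_natCast]
    gcongr
    exact (mul_le_mul_of_nonneg_left (h₁ k) (norm_nonneg _)).trans (by simp; positivity)
  · have hk := hX (-k)
    have h0 : (X * q ^ (-(k : ℤ)))⁻¹ = X⁻¹ * q ^ k := by
      rw [mul_inv, zpow_neg, inv_inv, zpow_natCast]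
    have h1 : 1 - X⁻¹ * q ^ k ≠ 0 := by
      rw [← h0]
      exact sub_ne_zero.2 (fun h => hk (inv_eq_one.1 h.symm))
    rcases Nat.eq_zero_or_pos k with rfl | hkp
    · have e : kroneckerCoeff q X 0 = -(X * (1 - X * q ^ 0)⁻¹) := by
        have hk := hX 0
        have h2 : 1 - X ≠ 0 := sub_ne_zero.2 (by simpa using hk.symm)
        have h3 : X - 1 ≠ 0 := sub_ne_zero.2 (by simpa using hk)
        have h4 : 1 - X⁻¹ = -(1 - X) / X := by field_simp; ring
        simp only [kroneckerCoeff, zpow_zero, mul_one, pow_zero]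
        rw [h4, inv_div]
        field_simp
      simp only [Nat.cast_zero, neg_zero, lt_self_iff_false, if_false, sub_zero, Int.natAbs_zero,
        pow_zero, mul_one]
      rw [e, norm_neg, norm_mul]
      exact (mul_le_mul_of_nonneg_left (h₁ 0) (norm_nonneg _)).trans (by simp; positivity)
    · have e : kroneckerCoeff q X (-k) - 1 = X⁻¹ * (1 - X⁻¹ * q ^ k)⁻¹ * q ^ k := by
        rw [kroneckerCoeff, h0]
        linear_combination mul_inv_cancel₀ h1
      rw [if_pos (by omega), e, norm_mul, norm_mul, norm_pow, Int.natAbs_neg, Int.natAbs_natCast]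
      gcongr
      exact (mul_le_mul_of_nonneg_left (h₂ k) (norm_nonneg _)).trans (by simp; positivity)

lemma summable_pow_natAbs {r : ℝ} (hr0 : 0 ≤ r) (hr : r < 1) :
    Summable fun n : ℤ => r ^ n.natAbs := by
  refine Summable.of_nat_of_neg ?_ ?_ <;> simpa using summable_geometric_of_lt_one hr0 hr

lemma pow_natAbs_mul_zpow_le {r s y : ℝ} (hs : 0 ≤ s) (hy : 0 < y) (h₁ : s * y ≤ r)
    (h₂ : s ≤ r * y) (n : ℤ) : s ^ n.natAbs * y ^ n ≤ r ^ n.natAbs := by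
  obtain ⟨k, rfl | rfl⟩ := n.eq_nat_or_neg
  · rw [Int.natAbs_natCast, zpow_natCast, ← mul_pow]
    exact pow_le_pow_left₀ (by positivity) h₁ k
  · rw [Int.natAbs_neg, Int.natAbs_natCast, zpow_neg, zpow_natCast, ← inv_pow, ← mul_pow]
    refine pow_le_pow_left₀ (by positivity) ?_ k
    rwa [← div_eq_mul_inv, div_le_iff₀ hy]

lemma hasSum_zpow_neg {Y : ℂ} (hY : 1 < ‖Y‖) :
    HasSum (fun n : ℤ => (if n < 0 then 1 else 0) * Y ^ n) (Y - 1)⁻¹ := by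
  have hY0 : Y ≠ 0 := norm_pos_iff.1 (one_pos.trans hY)
  have h := (hasSum_geometric_of_norm_lt_one (ξ := Y⁻¹)
    (by rw [norm_inv]; exact inv_lt_one_of_one_lt₀ hY)).mul_left Y⁻¹
  have e : Y⁻¹ * (1 - Y⁻¹)⁻¹ = (Y - 1)⁻¹ := by rw [← mul_inv, mul_sub, mul_inv_cancel₀ hY0, mul_one]
  rw [e] at h
  rw [← zero_add (Y - 1)⁻¹]
  refine HasSum.of_nat_of_neg_add_one ?_ ?_
  · simp [Int.not_lt.2 (Int.natCast_nonneg _)]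
  · have e2 (n : ℕ) : Y⁻¹ * Y⁻¹ ^ n =
        (if -((n : ℤ) + 1) < 0 then 1 else 0) * Y ^ (-((n : ℤ) + 1)) := by
      rw [if_pos (by omega), one_mul, zpow_neg, ← inv_zpow, zpow_add_one₀ (inv_ne_zero hY0),
        zpow_natCast, mul_comm]
    simpa only [e2] using h

lemma norm_kroneckerCoeff_sub_mul_zpow_le {q X Y : ℂ} {B r : ℝ} (hB0 : 0 ≤ B)
    (hB : ∀ n : ℤ, ‖kroneckerCoeff q X n - (if n < 0 then 1 else 0)‖ ≤ B * ‖q‖ ^ n.natAbs)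
    (hY : Y ≠ 0) (h₁ : ‖q‖ * ‖Y‖ ≤ r) (h₂ : ‖q‖ ≤ r * ‖Y‖) (n : ℤ) :
    ‖(kroneckerCoeff q X n - (if n < 0 then 1 else 0)) * Y ^ n‖ ≤ B * r ^ n.natAbs := by
  rw [norm_mul, norm_zpow]
  calc _ ≤ B * ‖q‖ ^ n.natAbs * ‖Y‖ ^ n := by gcongr; exact hB n
    _ ≤ _ := by
      rw [mul_assoc]
      gcongr
      exact pow_natAbs_mul_zpow_le (norm_nonneg _) (norm_pos_iff.2 hY) h₁ h₂ n

lemma summable_kroneckerCoeff_mul_zpow {q X Y : ℂ} (hq0 : q ≠ 0) (hq : ‖q‖ < 1) (hX0 : X ≠ 0)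
    (hX : ∀ n : ℤ, X * q ^ n ≠ 1) (hY : 1 < ‖Y‖) (hqY : ‖q‖ * ‖Y‖ < 1) :
    Summable fun n : ℤ => kroneckerCoeff q X n * Y ^ n := by
  obtain ⟨B, hB0, hB⟩ := exists_norm_kroneckerCoeff_sub_le hq0 hq hX0 hX
  have hY0 : Y ≠ 0 := norm_pos_iff.1 (one_pos.trans hY)
  have hs : Summable fun n : ℤ =>
      (kroneckerCoeff q X n - (if n < 0 then 1 else 0)) * Y ^ n := by
    refine Summable.of_norm_bounded
      ((summable_pow_natAbs (by positivity) hqY).mul_left B) fun n => ?_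
    refine norm_kroneckerCoeff_sub_mul_zpow_le hB0 hB hY0 le_rfl ?_ n
    rw [mul_assoc]
    exact le_mul_of_one_le_right (norm_nonneg _) (by nlinarith)
  refine (hs.add (hasSum_zpow_neg hY).summable).congr fun n => ?_
  ring

/-- If `c (j + 1) = -q ^ (j + 1) * c j` and `∑ c j = 0`, then the Laurent coefficients of the product
of `∑ c j Y ^ j` with the Kronecker series are proportional to `c m X ^ m`. -/
lemma tsum_mul_kroneckerCoeff_add_one {q X : ℂ} (hq0 : q ≠ 0) (hq : ‖q‖ < 1) (hX0 : X ≠ 0)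
    (hX : ∀ n : ℤ, X * q ^ n ≠ 1) {c : ℤ → ℂ} (hc : ∀ j, c (j + 1) = -q ^ (j + 1) * c j)
    (hs : Summable c) (h0 : ∑' j, c j = 0) (m : ℤ) :
    ∑' j, c j * kroneckerCoeff q X (m + 1 - j) =
      -q ^ (m + 1) * X * ∑' j, c j * kroneckerCoeff q X (m - j) := by
  obtain ⟨B, hB0, hB⟩ := exists_norm_kroneckerCoeff_sub_le hq0 hq hX0 hX
  have hbd (n : ℤ) : ‖kroneckerCoeff q X n‖ ≤ B + 1 := by
    calc _ = ‖(kroneckerCoeff q X n - (if n < 0 then 1 else 0)) + (if n < 0 then 1 else 0)‖ := by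
          rw [sub_add_cancel]
      _ ≤ B * ‖q‖ ^ n.natAbs + 1 := by
          refine (norm_add_le _ _).trans (add_le_add (hB n) ?_)
          split_ifs <;> simp
      _ ≤ B + 1 := by
          gcongr
          exact mul_le_of_le_one_right hB0 (pow_le_one₀ (norm_nonneg _) hq.le)
  have hsum : Summable fun j => c j * kroneckerCoeff q X (m - j) := by
    refine Summable.of_norm_bounded (hs.norm.mul_right (B + 1)) fun j => ?_
    rw [norm_mul]
    gcongr
    exact hbd _
  rw [← (Equiv.addRight (1 : ℤ)).tsum_eq fun j => c j * kroneckerCoeff q X (m + 1 - j)]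
  have key (j : ℤ) : c (j + 1) * kroneckerCoeff q X (m + 1 - (j + 1)) =
      -q ^ (m + 1) * X * (c j * kroneckerCoeff q X (m - j) - c j) := by
    have h1 : X * q ^ (m - j) ≠ 1 := hX _
    have h2 : 1 - (X * q ^ (m - j))⁻¹ ≠ 0 :=
      sub_ne_zero.2 fun h => h1 (inv_eq_one.1 h.symm)
    have h3 : q ^ (m + 1) = q ^ (j + 1) * q ^ (m - j) := by
      rw [← zpow_add₀ hq0]
      congr 1
      ring
    have h4 : X * q ^ (m - j) ≠ 0 := mul_ne_zero hX0 (zpow_ne_zero _ hq0)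
    have h5 : X * q ^ (m - j) * (kroneckerCoeff q X (m - j) - 1) = kroneckerCoeff q X (m - j) := by
      rw [kroneckerCoeff]
      linear_combination (X * q ^ (m - j)) * mul_inv_cancel₀ h2 +
        (1 - (X * q ^ (m - j))⁻¹)⁻¹ * mul_inv_cancel₀ h4
    rw [hc, h3, add_sub_add_right_eq_sub]
    linear_combination (q ^ (j + 1) * c j) * h5
  simp only [Equiv.coe_addRight, key]
  rw [tsum_mul_left, hsum.tsum_sub hs, h0, sub_zero]

lemma tsum_mul_kroneckerCoeff {q X : ℂ} (hq0 : q ≠ 0) (hq : ‖q‖ < 1) (hX0 : X ≠ 0)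
    (hX : ∀ n : ℤ, X * q ^ n ≠ 1) {c : ℤ → ℂ} (hc : ∀ j, c (j + 1) = -q ^ (j + 1) * c j)
    (hc0 : c 0 ≠ 0) (hs : Summable c) (h0 : ∑' j, c j = 0) :
    ∃ K : ℂ, ∀ m : ℤ, ∑' j, c j * kroneckerCoeff q X (m - j) = K * (c m * X ^ m) := by
  refine ⟨(∑' j, c j * kroneckerCoeff q X (0 - j)) / c 0, fun m => ?_⟩
  have hrec := tsum_mul_kroneckerCoeff_add_one hq0 hq hX0 hX hc hs h0
  induction m with
  | zero => rw [zpow_zero, mul_one, div_mul_cancel₀ _ hc0]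
  | succ n ih => rw [hrec, ih, hc, zpow_add_one₀ hX0]; ring
  | pred n ih =>
    have h1 := hrec (-n - 1)
    have h2 := hc (-n - 1)
    have h3 : X ^ (-(n : ℤ)) = X ^ (-(n : ℤ) - 1) * X := by
      rw [← zpow_add_one₀ hX0, sub_add_cancel]
    rw [sub_add_cancel] at h1 h2
    rw [ih, h2, h3] at h1
    refine mul_left_cancel₀
      (mul_ne_zero (neg_ne_zero.2 (zpow_ne_zero (-(n : ℤ)) hq0)) hX0) (h1.symm.trans ?_)
    ring

lemma tsum_zpow_mul_tsum_kroneckerCoeff {q X : ℂ} (hq0 : q ≠ 0) (hq : ‖q‖ < 1) (hX0 : X ≠ 0)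
    (hX : ∀ n : ℤ, X * q ^ n ≠ 1) {c : ℤ → ℂ} (hc : ∀ j, c (j + 1) = -q ^ (j + 1) * c j)
    (hc0 : c 0 ≠ 0) (hs : ∀ Y : ℂ, Y ≠ 0 → Summable fun j => c j * Y ^ j)
    (h0 : ∑' j, c j = 0) :
    ∃ K : ℂ, ∀ Y : ℂ, 1 < ‖Y‖ → ‖q‖ * ‖Y‖ < 1 →
      (∑' j, c j * Y ^ j) * (∑' n, kroneckerCoeff q X n * Y ^ n) =
        K * ∑' j, c j * (X * Y) ^ j := by
  obtain ⟨K, hK⟩ := tsum_mul_kroneckerCoeff hq0 hq hX0 hX hc hc0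
    (by simpa using hs 1 one_ne_zero) h0
  refine ⟨K, fun Y hY hqY => ?_⟩
  have hY0 : Y ≠ 0 := norm_pos_iff.1 (one_pos.trans hY)
  have hsum := summable_kroneckerCoeff_mul_zpow hq0 hq hX0 hX hY hqY
  let e : ℤ × ℤ ≃ ℤ × ℤ :=
    { toFun := fun p => (p.2, p.1 - p.2)
      invFun := fun p => (p.1 + p.2, p.1)
      left_inv := fun p => by simp
      right_inv := fun p => by simp }
  have hprod := summable_mul_of_summable_norm (hs Y hY0).norm hsum.norm
  rw [tsum_mul_tsum_of_summable_norm (hs Y hY0).norm hsum.norm, ← e.tsum_eq]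
  refine (Summable.tsum_prod (e.summable_iff.2 hprod)).trans ?_
  rw [← tsum_mul_left]
  refine tsum_congr fun m => ?_
  rw [mul_zpow, ← mul_assoc (c m), ← mul_assoc, ← hK m, ← tsum_mul_right]
  refine tsum_congr fun j => ?_
  have : Y ^ m = Y ^ j * Y ^ (m - j) := by rw [← zpow_add₀ hY0, add_sub_cancel]
  simp only [e, Function.comp_apply, Equiv.coe_fn_mk, this]
  ring

lemma one_half_mul_one_add_coth {v : ℂ} (hv : Complex.exp (2 * v) ≠ 1) :
    (1 / 2 : ℂ) * (1 + coth v) = (1 - (Complex.exp (2 * v))⁻¹)⁻¹ := by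
  have h2 : Complex.exp (2 * v) = Complex.exp v * Complex.exp v := by
    rw [← Complex.exp_add, two_mul]
  rw [h2] at hv ⊢
  have he := Complex.exp_ne_zero v
  have h3 : Complex.exp v * Complex.exp v - 1 ≠ 0 := sub_ne_zero.2 hv
  have h4 : Complex.exp v - (Complex.exp v)⁻¹ ≠ 0 := fun h => h3 <| by
    have := congrArg (· * Complex.exp v) h
    simpa [sub_mul, he] using this
  have h5 := mul_inv_cancel₀ he
  refine eq_inv_of_mul_eq_one_left ?_
  rw [coth, Complex.cosh, Complex.sinh, Complex.exp_neg, mul_inv]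
  generalize (Complex.exp v)⁻¹ = F at *
  field_simp
  linear_combination (-2 * F) * h5

/-- The Fourier coefficients of `-θ₁(z|τ) exp (-π i z)`. -/
noncomputable def theta1Coeff (τ : ℂ) (j : ℤ) : ℂ :=
  Complex.exp (Real.pi * I * ((j : ℂ) + 1 / 2) ^ 2 * τ + Real.pi * I * ((j : ℂ) + 1 / 2))

lemma theta1Coeff_add_one (τ : ℂ) (j : ℤ) :
    theta1Coeff τ (j + 1) = -Complex.exp (2 * Real.pi * I * τ) ^ (j + 1) * theta1Coeff τ j := by
  rw [theta1Coeff, theta1Coeff, ← Complex.exp_int_mul, ← neg_one_mul, ← Complex.exp_pi_mul_I,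
    ← Complex.exp_add, ← Complex.exp_add]
  congr 1
  push_cast
  ring

lemma theta1Coeff_mul_zpow (z τ : ℂ) (j : ℤ) :
    theta1Coeff τ j * Complex.exp (2 * Real.pi * I * z) ^ j =
      Complex.exp (Real.pi * I * τ / 4 + Real.pi * I / 2) *
        jacobiTheta₂_term j (z + 1 / 2 + τ / 2) τ := by
  rw [theta1Coeff, jacobiTheta₂_term, ← Complex.exp_int_mul, ← Complex.exp_add, ← Complex.exp_add]
  congr 1
  ring

lemma summable_theta1Coeff_mul_zpow {τ : ℂ} (hτ : 0 < τ.im) {Y : ℂ} (hY : Y ≠ 0) :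
    Summable fun j => theta1Coeff τ j * Y ^ j := by
  have hY' : Complex.exp (2 * Real.pi * I * (Complex.log Y / (2 * Real.pi * I))) = Y := by
    rw [mul_div_cancel₀ _ Complex.two_pi_I_ne_zero, Complex.exp_log hY]
  rw [← hY']
  simp only [theta1Coeff_mul_zpow]
  exact ((summable_jacobiTheta₂_term_iff _ _).2 hτ).mul_left _

lemma theta1_eq_tsum_theta1Coeff (z τ : ℂ) :
    theta1 z τ = -Complex.exp (Real.pi * I * z) *
      ∑' j, theta1Coeff τ j * Complex.exp (2 * Real.pi * I * z) ^ j := by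
  rw [theta1, neg_mul, ← tsum_mul_left]
  congr 1
  refine tsum_congr fun j => ?_
  rw [theta1Coeff, ← Complex.exp_int_mul, ← Complex.exp_add, ← Complex.exp_add]
  congr 1
  ring

lemma differentiable_theta1 {τ : ℂ} (hτ : 0 < τ.im) : Differentiable ℂ fun z => theta1 z τ := by
  have h (z : ℂ) : theta1 z τ = -Complex.exp (Real.pi * I * z) *
      (Complex.exp (Real.pi * I * τ / 4 + Real.pi * I / 2) *
        jacobiTheta₂ (z + 1 / 2 + τ / 2) τ) := by
    rw [theta1_eq_tsum_theta1Coeff, jacobiTheta₂, ← tsum_mul_left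
      (a := Complex.exp (Real.pi * I * τ / 4 + Real.pi * I / 2))]
    simp only [theta1Coeff_mul_zpow]
  simp only [h]
  have h2 : Differentiable ℂ fun z : ℂ => jacobiTheta₂ (z + 1 / 2 + τ / 2) τ := fun z =>
    (differentiableAt_jacobiTheta₂_fst _ hτ).comp z
      (f := fun z : ℂ => z + 1 / 2 + τ / 2) (by fun_prop)
  fun_prop

lemma tsum_theta1Coeff (τ : ℂ) : ∑' j, theta1Coeff τ j = 0 := by
  have h (j : ℤ) : theta1Coeff τ (-1 - j) = -theta1Coeff τ j := by
    rw [theta1Coeff, theta1Coeff, ← neg_one_mul (Complex.exp _), ← Complex.exp_pi_mul_I,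
      ← Complex.exp_add, Complex.exp_eq_exp_iff_exists_int]
    refine ⟨-1 - j, ?_⟩
    push_cast
    ring
  have h2 := (Equiv.subLeft (-1 : ℤ)).tsum_eq (theta1Coeff τ)
  simp only [Equiv.subLeft_apply, h, tsum_neg] at h2
  exact self_eq_neg.1 h2.symm

lemma theta1_zero (τ : ℂ) : theta1 0 τ = 0 := by
  rw [theta1_eq_tsum_theta1Coeff]
  simp [tsum_theta1Coeff]

lemma norm_exp_two_pi_I_mul (z : ℂ) :
    ‖Complex.exp (2 * Real.pi * I * z)‖ = Real.exp (-(2 * Real.pi * z.im)) := by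
  rw [Complex.norm_exp]
  simp

/-- Kronecker's series: a quotient of theta functions as a bilateral series. -/
lemma tsum_kroneckerCoeff_mul_theta1 {τ x : ℂ} (hτ : 0 < τ.im)
    (hX : ∀ n : ℤ, exp (2 * Real.pi * I * x) * exp (2 * Real.pi * I * τ) ^ n ≠ 1) {z : ℂ}
    (hz1 : -τ.im < z.im) (hz2 : z.im < 0) :
    theta1 z τ * theta1 x τ * ∑' n : ℤ, kroneckerCoeff (exp (2 * Real.pi * I * τ))
        (exp (2 * Real.pi * I * x)) n * exp (2 * Real.pi * I * z) ^ n =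
      1 / (2 * Real.pi * I) * theta1 (x + z) τ * theta1Deriv 0 τ := by
  set q := exp (2 * Real.pi * I * τ) with hqdef
  set X := exp (2 * Real.pi * I * x) with hXdef
  have hq0 : q ≠ 0 := exp_ne_zero _
  have hX0 : X ≠ 0 := exp_ne_zero _
  have hq : ‖q‖ < 1 := by
    rw [hqdef, norm_exp_two_pi_I_mul, Real.exp_lt_one_iff]
    have := Real.pi_pos
    simp only [Left.neg_neg_iff]
    positivity
  obtain ⟨K, hK⟩ := tsum_zpow_mul_tsum_kroneckerCoeff hq0 hq hX0 hX (theta1Coeff_add_one τ)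
    (exp_ne_zero _) (fun Y hY => summable_theta1Coeff_mul_zpow hτ hY) (tsum_theta1Coeff τ)
  obtain ⟨B, hB0, hB⟩ := exists_norm_kroneckerCoeff_sub_le hq0 hq hX0 hX
  set Y : ℂ → ℂ := fun z => exp (2 * Real.pi * I * z) with hYdef
  have hYnorm {z : ℂ} (h : z.im < 0) : 1 < ‖Y z‖ := by
    rw [hYdef, norm_exp_two_pi_I_mul, Real.one_lt_exp_iff]
    have := Real.pi_pos
    nlinarith
  have hqY {z : ℂ} (h : -τ.im < z.im) : ‖q‖ * ‖Y z‖ < 1 := by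
    rw [hYdef, hqdef, norm_exp_two_pi_I_mul, norm_exp_two_pi_I_mul, ← Real.exp_add,
      Real.exp_lt_one_iff]
    have := Real.pi_pos
    nlinarith
  set S : ℂ → ℂ := fun z => ∑' n : ℤ, kroneckerCoeff q X n * Y z ^ n with hS
  set D := K * exp (-(Real.pi * I * x)) with hD
  have hprod {z : ℂ} (h1 : -τ.im < z.im) (h2 : z.im < 0) :
      theta1 z τ * S z = D * theta1 (x + z) τ := by
    have e1 : exp (2 * Real.pi * I * (x + z)) = X * Y z := by
      rw [mul_add, exp_add]
    have e2 : exp (-(Real.pi * I * x)) * exp (Real.pi * I * (x + z)) = exp (Real.pi * I * z) := by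
      rw [← exp_add]
      congr 1
      ring
    rw [theta1_eq_tsum_theta1Coeff, theta1_eq_tsum_theta1Coeff, e1, hD, mul_assoc,
      hK (Y z) (hYnorm h2) (hqY h1), ← e2]
    ring
  set T : ℂ → ℂ := fun z =>
    ∑' n : ℤ, (kroneckerCoeff q X n - (if n < 0 then 1 else 0)) * Y z ^ n with hT
  set l : Filter ℂ := 𝓝[{z | z.im < 0}] 0 with hl
  have : l.NeBot := by
    rw [hl, ← mem_closure_iff_nhdsWithin_neBot, Complex.closure_setOfPred_im_lt]
    simp
  have hl0 : l ≤ 𝓝[≠] 0 := nhdsWithin_mono _ fun z hz => by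
    rintro rfl
    simp at hz
  have hl1 : l ≤ 𝓝 0 := nhdsWithin_le_nhds
  have hneg : ∀ᶠ z in l, z.im < 0 := eventually_mem_nhdsWithin
  have hstrip : ∀ᶠ z in l, -(τ.im / 2) < z.im :=
    hl1 <| continuous_im.continuousAt.eventually (lt_mem_nhds (by simpa using hτ))
  have hθ : Differentiable ℂ fun z => theta1 z τ := differentiable_theta1 hτ
  have hsplit : ∀ᶠ z in l, S z = (Y z - 1)⁻¹ + T z ∧
      ‖T z‖ ≤ ∑' n : ℤ, B * Real.sqrt ‖q‖ ^ n.natAbs := by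
    filter_upwards [hneg, hstrip] with z h1 h2
    have hr : Real.sqrt ‖q‖ = Real.exp (-(Real.pi * τ.im)) := by
      rw [hqdef, norm_exp_two_pi_I_mul, Real.sqrt_eq_iff_mul_self_eq (Real.exp_pos _).le
        (Real.exp_pos _).le, ← Real.exp_add]
      congr 1
      ring
    have hr1 : Real.sqrt ‖q‖ < 1 := by
      rw [Real.sqrt_lt' one_pos, one_pow]
      exact hq
    have hqq : Real.sqrt ‖q‖ * Real.sqrt ‖q‖ = ‖q‖ := Real.mul_self_sqrt (norm_nonneg _)
    have hb1 : Real.sqrt ‖q‖ * ‖Y z‖ ≤ 1 := by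
      rw [hr, hYdef, norm_exp_two_pi_I_mul, ← Real.exp_add, Real.exp_le_one_iff]
      have := Real.pi_pos
      nlinarith
    have hb (n : ℤ) := norm_kroneckerCoeff_sub_mul_zpow_le (r := Real.sqrt ‖q‖) hB0 hB
      (exp_ne_zero (2 * Real.pi * I * z))
      (by
        nth_rw 1 [← hqq]
        rw [mul_assoc]
        exact mul_le_of_le_one_right (Real.sqrt_nonneg _) hb1)
      (by
        nth_rw 1 [← hqq]
        gcongr
        exact hr1.le.trans (hYnorm h1).le) n
    have hs : Summable fun n : ℤ => B * Real.sqrt ‖q‖ ^ n.natAbs :=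
      (summable_pow_natAbs (Real.sqrt_nonneg _) hr1).mul_left B
    refine ⟨?_, tsum_of_norm_bounded hs.hasSum hb⟩
    rw [← (hasSum_zpow_neg (hYnorm h1)).tsum_eq, hS, hT,
      ← (hasSum_zpow_neg (hYnorm h1)).summable.tsum_add (Summable.of_norm_bounded hs hb)]
    refine tsum_congr fun n => ?_
    ring
  have hθ0 : Tendsto (fun z => theta1 z τ) l (𝓝 0) := by
    have := hθ.continuous.tendsto 0
    rw [theta1_zero] at this
    exact this.mono_left hl1
  have hlim1 : Tendsto (fun z => theta1 z τ * (Y z - 1)⁻¹) l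
      (𝓝 (theta1Deriv 0 τ * (2 * Real.pi * I)⁻¹)) := by
    have d1 : Tendsto (fun z : ℂ => z⁻¹ * theta1 z τ) l (𝓝 (theta1Deriv 0 τ)) := by
      have := (hasDerivAt_iff_tendsto_slope_zero.1 (hθ 0).hasDerivAt).mono_left hl0
      simpa [theta1_zero, theta1Deriv] using this
    have hY' : HasDerivAt Y (2 * Real.pi * I) 0 := by
      simpa using ((hasDerivAt_id (0 : ℂ)).const_mul (2 * Real.pi * I)).cexp
    have d2 : Tendsto (fun z : ℂ => z⁻¹ * (Y z - 1)) l (𝓝 (2 * Real.pi * I)) := by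
      have := (hasDerivAt_iff_tendsto_slope_zero.1 hY').mono_left hl0
      simpa [hYdef] using this
    refine (d1.mul (d2.inv₀ two_pi_I_ne_zero)).congr' ?_
    filter_upwards [hneg] with z hz
    have hz0 : z ≠ 0 := by
      rintro rfl
      simp at hz
    rw [mul_inv, inv_inv]
    field_simp
  have hlim2 : Tendsto (fun z => theta1 z τ * T z) l (𝓝 0) :=
    hθ0.zero_mul_isBoundedUnder_le
      ⟨_, eventually_map.2 (hsplit.mono fun z hz => hz.2)⟩
  have hlim3 : Tendsto (fun z => D * theta1 (x + z) τ) l (𝓝 (D * theta1 (x + 0) τ)) :=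
    ((hθ.continuous.comp (continuous_const_add x)).tendsto 0).mono_left hl1 |>.const_mul D
  have hDval : D * theta1 x τ = theta1Deriv 0 τ * (2 * Real.pi * I)⁻¹ := by
    rw [add_zero] at hlim3
    refine tendsto_nhds_unique hlim3 ?_
    rw [← add_zero (theta1Deriv 0 τ * (2 * Real.pi * I)⁻¹)]
    refine (hlim1.add hlim2).congr' ?_
    filter_upwards [hneg, hstrip, hsplit] with z h1 h2 h3
    rw [← hprod (by linarith) h1, h3.1]
    ring
  have := hprod hz1 hz2
  linear_combination theta1 x τ * this + theta1 (x + z) τ * hDval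

/-- For `Im τ > 0`, `N ≥ 1`, `a ∈ {0,…,N−1}`, `−Im τ < Im z < 0`,
`w ∉ 2πiΩ_a` (with `Ω_a := (Ω − (a/N)τ) ∖ {0}`, `Ω = ℤ + τℤ`), `w ≠ 0` if `a = 0`,
`θ₁(z|τ) ≠ 0` and `θ₁((w + 2πi(a/N)τ)/(2πi)|τ) ≠ 0`, the family
`n ↦ e^{2πizn}·(1 + coth(w/2 + πi(a/N)τ + πiτn))`, `n ∈ ℤ∖{0}`, is absolutely summable,
and `χ_a(w,z|τ) = e^{2πiaz/N}·(f_a(w + 2πi(a/N)τ) + (1/2)·∑_{n≠0} …)` where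
`f_a(u) := (1/2)(1 + coth(u/2)) − δ_{a,0}/u`. -/
theorem chia_series (τ : ℂ) (hτ : 0 < τ.im) (N : ℕ) (hN : 1 ≤ N) (a : ℕ) (ha : a < N)
    (w z : ℂ) (hz1 : -τ.im < z.im) (hz2 : z.im < 0)
    (hw : ∀ m n : ℤ, (m : ℂ) + (n : ℂ) * τ - ((a : ℂ) / (N : ℂ)) * τ ≠ 0 →
        w ≠ 2 * (Real.pi : ℂ) * I * ((m : ℂ) + (n : ℂ) * τ - ((a : ℂ) / (N : ℂ)) * τ))
    (hw0 : a = 0 → w ≠ 0)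
    (hθz : theta1 z τ ≠ 0)
    (hθw : theta1 ((w + 2 * (Real.pi : ℂ) * I * ((a : ℂ) / (N : ℂ)) * τ) /
        (2 * (Real.pi : ℂ) * I)) τ ≠ 0) :
    Summable (fun n : {n : ℤ // n ≠ 0} =>
      ‖Complex.exp (2 * (Real.pi : ℂ) * I * z * ((n : ℤ) : ℂ)) *
        (1 + coth (w / 2 + (Real.pi : ℂ) * I * ((a : ℂ) / (N : ℂ)) * τ +
          (Real.pi : ℂ) * I * τ * ((n : ℤ) : ℂ)))‖) ∧
    chia N a w z τ =
      Complex.exp (2 * (Real.pi : ℂ) * I * (a : ℂ) * z / (N : ℂ)) *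
        (((1 / 2 : ℂ) * (1 + coth ((w + 2 * (Real.pi : ℂ) * I * ((a : ℂ) / (N : ℂ)) * τ) / 2)) -
            (if a = 0 then 1 / (w + 2 * (Real.pi : ℂ) * I * ((a : ℂ) / (N : ℂ)) * τ) else 0)) +
          (1 / 2 : ℂ) * ∑' n : {n : ℤ // n ≠ 0},
            Complex.exp (2 * (Real.pi : ℂ) * I * z * ((n : ℤ) : ℂ)) *
              (1 + coth (w / 2 + (Real.pi : ℂ) * I * ((a : ℂ) / (N : ℂ)) * τ +
                (Real.pi : ℂ) * I * τ * ((n : ℤ) : ℂ)))) := by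
  set u := w + 2 * (Real.pi : ℂ) * I * ((a : ℂ) / (N : ℂ)) * τ with hu
  set q := Complex.exp (2 * Real.pi * I * τ) with hq
  have h2pi : (2 * Real.pi * I : ℂ) ≠ 0 := Complex.two_pi_I_ne_zero
  have hN0 : (N : ℂ) ≠ 0 := by
    exact_mod_cast (by omega : N ≠ 0)
  have hxu : 2 * Real.pi * I * (u / (2 * Real.pi * I)) = u := mul_div_cancel₀ _ h2pi
  have hX (n : ℤ) : Complex.exp u * q ^ n ≠ 1 := by
    rw [hq, ← Complex.exp_int_mul, ← Complex.exp_add, Ne, Complex.exp_eq_one_iff]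
    rintro ⟨m, hm⟩
    have hw' : w = 2 * (Real.pi : ℂ) * I *
        ((m : ℂ) + ((-n : ℤ) : ℂ) * τ - ((a : ℂ) / (N : ℂ)) * τ) := by
      push_cast
      linear_combination hm + hu
    by_cases h0 : (m : ℂ) + ((-n : ℤ) : ℂ) * τ - ((a : ℂ) / (N : ℂ)) * τ = 0
    · have hτn : (N * n + a : ℤ) * τ = ((N * m : ℤ) : ℂ) := by
        push_cast at h0 ⊢
        field_simp at h0
        linear_combination -h0
      have him := congrArg Complex.im hτn
      rw [Complex.mul_im, Complex.intCast_im, Complex.intCast_im, zero_mul, add_zero,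
        Complex.intCast_re, mul_eq_zero, or_iff_left hτ.ne'] at him
      have hna : (N * n + a : ℤ) = 0 := by exact_mod_cast him
      have hdvd : (N : ℤ) ∣ a := ⟨-n, by linarith⟩
      have ha0 : a = 0 := Nat.eq_zero_of_dvd_of_lt (Int.natCast_dvd_natCast.1 hdvd) ha
      rw [h0, mul_zero] at hw'
      exact hw0 ha0 hw'
    · exact hw m (-n) h0 hw'
  have hterm (n : ℤ) : (1 / 2 : ℂ) * (Complex.exp (2 * (Real.pi : ℂ) * I * z * (n : ℂ)) *
        (1 + coth (w / 2 + (Real.pi : ℂ) * I * ((a : ℂ) / (N : ℂ)) * τ +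
          (Real.pi : ℂ) * I * τ * (n : ℂ)))) =
      kroneckerCoeff q (Complex.exp u) n * Complex.exp (2 * Real.pi * I * z) ^ n := by
    have h1 : Complex.exp (2 * (w / 2 + (Real.pi : ℂ) * I * ((a : ℂ) / (N : ℂ)) * τ +
        (Real.pi : ℂ) * I * τ * (n : ℂ))) = Complex.exp u * q ^ n := by
      rw [hq, ← Complex.exp_int_mul, ← Complex.exp_add, hu]
      congr 1
      ring
    rw [kroneckerCoeff, ← h1, ← one_half_mul_one_add_coth (h1 ▸ hX n), ← Complex.exp_int_mul,
      mul_comm (n : ℂ)]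
    ring
  have hpi := Real.pi_pos
  have hsum : Summable fun n : ℤ =>
      kroneckerCoeff q (Complex.exp u) n * Complex.exp (2 * Real.pi * I * z) ^ n := by
    refine summable_kroneckerCoeff_mul_zpow (Complex.exp_ne_zero _) ?_ (Complex.exp_ne_zero _) hX
      ?_ ?_
    · rw [hq, norm_exp_two_pi_I_mul, Real.exp_lt_one_iff]
      nlinarith
    · rw [norm_exp_two_pi_I_mul, Real.one_lt_exp_iff]
      nlinarith
    · rw [hq, norm_exp_two_pi_I_mul, norm_exp_two_pi_I_mul, ← Real.exp_add, Real.exp_lt_one_iff]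
      nlinarith
  refine ⟨?_, ?_⟩
  · refine (((hsum.subtype {n : ℤ | n ≠ 0}).mul_left 2).norm).congr fun n => ?_
    rw [Function.comp_apply, ← hterm, ← mul_assoc]
    norm_num
  · have hkey := tsum_kroneckerCoeff_mul_theta1 (x := u / (2 * Real.pi * I)) hτ
      (by rw [hxu]; exact hX) hz1 hz2
    rw [hxu] at hkey
    have hsplit := hsum.tsum_subtype_add_tsum_subtype_compl {n : ℤ | n = 0}
    have hzero : ∑' n : {n : ℤ | n = 0}, kroneckerCoeff q (Complex.exp u) n *
        Complex.exp (2 * Real.pi * I * z) ^ (n : ℤ) = (1 / 2 : ℂ) * (1 + coth (u / 2)) := by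
      have h0 : (w / 2 + (Real.pi : ℂ) * I * ((a : ℂ) / (N : ℂ)) * τ +
          (Real.pi : ℂ) * I * τ * ((0 : ℤ) : ℂ)) = u / 2 := by
        rw [hu]
        push_cast
        ring
      have h1 := hterm 0
      rw [h0] at h1
      rw [Set.ofPred_eq_eq_singleton, tsum_singleton (0 : ℤ) fun n : ℤ =>
        kroneckerCoeff q (Complex.exp u) n * Complex.exp (2 * Real.pi * I * z) ^ n, ← h1]
      simp
    have hcompl : ∑' n : ({n : ℤ | n = 0}ᶜ : Set ℤ), kroneckerCoeff q (Complex.exp u) n *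
        Complex.exp (2 * Real.pi * I * z) ^ (n : ℤ) =
        (1 / 2 : ℂ) * ∑' n : {n : ℤ // n ≠ 0},
            Complex.exp (2 * (Real.pi : ℂ) * I * z * ((n : ℤ) : ℂ)) *
              (1 + coth (w / 2 + (Real.pi : ℂ) * I * ((a : ℂ) / (N : ℂ)) * τ +
                (Real.pi : ℂ) * I * τ * ((n : ℤ) : ℂ))) := by
      rw [← tsum_mul_left]
      exact tsum_congr fun n => (hterm n).symm
    have hchi : chi u z τ = ∑' n : ℤ,
        kroneckerCoeff q (Complex.exp u) n * Complex.exp (2 * Real.pi * I * z) ^ n := by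
      rw [chi, ← hkey, mul_div_cancel_left₀ _ (mul_ne_zero hθz hθw)]
    have hdelta : (if a = 0 then 1 / u else 0) = if a = 0 then 1 / w else 0 := by
      split_ifs with h
      · simp [hu, h]
      · rfl
    rw [chia, ← hu, hdelta, hchi, ← hsplit, hzero, hcompl]
    ring
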